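/- arXiv:2410.19242 — 2 statements merged into one kernel-verified Lean document; each statement's English description precedes it below -/
import Mathlib

section
/- Let ℐ be a decreasing set of monomials in x_1,…,x_m whose maximum degree is r, let 0 ≤ i ≤ N, and let Y_i := {N−i+1,…,N} be the Wang-Liu shortening pattern. Then the number of Hamming-weight-2^{m−r} codewords of the shortened code C_S(ℐ, Y_i) equals Σ_{f ∈ ℐ, deg f = r} P_f(2^{m−r}, i), where P_f(w,i) := |{p ∈ T(f) : wt(p_{[i+1,N]}) = w}|. -/
open Finset

/-- Points of 𝔽₂^m (exponent/evaluation index vectors), 0-based coordinates: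
coordinate `i : Fin m` corresponds to the paper's variable `x_{i+1}`. -/
abbrev Pt (m : ℕ) := Fin m → ZMod 2

/-- Multilinear polynomials over 𝔽₂ in x_1,…,x_m, represented (bijectively) by
their evaluation functions 𝔽₂^m → 𝔽₂. -/
abbrev BPoly (m : ℕ) := Pt m → ZMod 2

/-- D(a) = Σ_{i=1}^m 2^{i-1}(a_i ⊕ 1) + 1. -/
def Dnat {m : ℕ} (a : Pt m) : ℕ := (∑ i : Fin m, 2 ^ (i : ℕ) * (1 - (a i).val)) + 1

/-- D(a_m,…,a_1) = Σ_{i=1}^m 2^{m-i}(a_i ⊕ 1) + 1 (the bit-reversed index). -/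
def Drev {m : ℕ} (a : Pt m) : ℕ := (∑ i : Fin m, 2 ^ (m - 1 - (i : ℕ)) * (1 - (a i).val)) + 1

/-- Hamming weight of the window ev(p)_{[s,t]} (positions s..t, 1-based). -/
def wtIn {m : ℕ} (p : BPoly m) (s t : ℕ) : ℕ :=
  (Finset.univ.filter (fun a : Pt m => s ≤ Dnat a ∧ Dnat a ≤ t ∧ p a = 1)).card

/-- Hamming weight of ev(p). -/
def wt {m : ℕ} (p : BPoly m) : ℕ :=
  (Finset.univ.filter (fun a : Pt m => p a = 1)).card

/-- T(f) for the monomial f with (0-based) index set S: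
all products ∏_{j∈S} (x_j + Σ_{k∈B(f,j)} a_{j,k} x_k + a_{j,0}),
where B(f,j) = {k < j : k ∉ S}. -/
def Tset {m : ℕ} (S : Finset (Fin m)) : Set (BPoly m) :=
  {p | ∃ (c : Fin m → Fin m → ZMod 2) (c0 : Fin m → ZMod 2),
    p = fun x => ∏ j ∈ S,
      (x j + (∑ k ∈ Finset.univ.filter (fun k => k < j ∧ k ∉ S), c j k * x k) + c0 j)}

/-- λ_f = 2^{Σ_{t=1}^r (i_t - t + 1)} (here with 0-based sorted indices:
the t-th smallest element e_t of S contributes e_t - t + 1, t = 0,…,r-1). -/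
def lam {m : ℕ} (S : Finset (Fin m)) : ℕ :=
  2 ^ ∑ t : Fin S.card, (((S.orderIsoOfFin rfl t : Fin m) : ℕ) - (t : ℕ) + 1)

/-- Support of an exponent vector, i.e. the index set of the monomial it encodes. -/
def suppOf {m : ℕ} (b : Pt m) : Finset (Fin m) :=
  Finset.univ.filter (fun k => b k = 1)

/-- Coefficient of the monomial with index set S in the multilinear expansion of p
(Möbius inversion over 𝔽₂: c_S = Σ_{a with supp a ⊆ S} p(a)). -/
def coeff {m : ℕ} (S : Finset (Fin m)) (p : BPoly m) : ZMod 2 :=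
  ∑ a ∈ Finset.univ.filter (fun a : Pt m => ∀ i, a i = 1 → i ∈ S), p a

/-- T_S^c(f,i): members of T(f) whose coefficients vanish on each of the first i
monomials in the bit-reversal shortening order (g is among the first i shortened
monomials iff Drev g ≥ 2^m - i + 1). -/
def TSc {m : ℕ} (S : Finset (Fin m)) (i : ℕ) : Set (BPoly m) :=
  {p | p ∈ Tset S ∧ ∀ b : Pt m, 2 ^ m - i + 1 ≤ Drev b → coeff (suppOf b) p = 0}

/-- Exponent vector of the monomial with index set S. -/
def indOf {m : ℕ} (S : Finset (Fin m)) : Pt m := fun k => if k ∈ S then 1 else 0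

/-- β_f(i): number of monomials among the first i shortened (bit-reversal order)
that are factors of the monomial with index set S. -/
noncomputable def betaf {m : ℕ} (S : Finset (Fin m)) (i : ℕ) : ℕ :=
  {b : Pt m | 2 ^ m - i + 1 ≤ Drev b ∧ ∀ k, b k = 1 → k ∈ S}.ncard

/-- The partial order ≼ on monomials (given by their index sets):
x_{i_1}…x_{i_t} ≼ x_{j_1}…x_{j_s} iff t ≤ s and i_{t-l} ≤ j_{s-l} for 0 ≤ l ≤ t-1. -/
def MonLE {m : ℕ} (S T : Finset (Fin m)) : Prop :=
  S.card ≤ T.card ∧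
    List.Forall₂ (· ≤ ·) (S.sort (· ≤ ·)) (List.drop (T.card - S.card) (T.sort (· ≤ ·)))

/-- Evaluation vector of the monomial with index set S. -/
def evMon {m : ℕ} (S : Finset (Fin m)) : BPoly m := fun a => ∏ i ∈ S, a i

/-- The monomial code C(ℐ): the 𝔽₂-span of the evaluation vectors of ℐ. -/
def Ccode {m : ℕ} (ℐ : Finset (Finset (Fin m))) : Submodule (ZMod 2) (BPoly m) :=
  Submodule.span (ZMod 2) (evMon '' (↑ℐ : Set (Finset (Fin m))))

/-- N_f(w,a) = |{p ∈ T(f) : wt(p_{[1,a]}) = w}|. -/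
noncomputable def Nfun {m : ℕ} (S : Finset (Fin m)) (w a : ℕ) : ℕ :=
  {p : BPoly m | p ∈ Tset S ∧ wtIn p 1 a = w}.ncard

/-- P_f(w,i) = |{p ∈ T(f) : wt(p_{[i+1,N]}) = w}|. -/
noncomputable def Pf {m : ℕ} (S : Finset (Fin m)) (w i : ℕ) : ℕ :=
  {p : BPoly m | p ∈ Tset S ∧ wtIn p (i + 1) (2 ^ m) = w}.ncard

/-- The Reed–Muller code of order `r`: multilinear polynomials of degree at most `r`. -/
def reedMuller (m r : ℕ) : Submodule (ZMod 2) (BPoly m) :=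
  Submodule.span (ZMod 2) (evMon '' {S | S.card ≤ r})

/-- Affine functions of the variables indexed by `A`. -/
def affineOn {m : ℕ} (A : Finset (Fin m)) : Submodule (ZMod 2) (BPoly m) :=
  Submodule.span (ZMod 2) (insert 1 ((fun k x => x k) '' (A : Set (Fin m))))

/-- Dominance of monomials: above every threshold, `U` has at most as many variables as `S`. -/
def Dominated {m : ℕ} (U S : Finset (Fin m)) : Prop :=
  ∀ t : ℕ, (U.filter fun k : Fin m => t ≤ (k : ℕ)).card ≤ (S.filter fun k : Fin m => t ≤ (k : ℕ)).card

/-- Restriction of a polynomial in `m + 1` variables to a value of the last variable. -/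
def restrictLast {m : ℕ} (b : ZMod 2) (p : BPoly (m + 1)) : BPoly m :=
  fun x => p (Fin.snoc x b)

section Weight

variable {m : ℕ}

lemma zmod_two_eq_one {a : ZMod 2} (h : a ≠ 0) : a = 1 := by
  revert a; decide

lemma wt_eq_sum (p : BPoly m) : wt p = ∑ a, (p a).val := by
  rw [wt, Finset.card_filter]
  refine Finset.sum_congr rfl fun a _ => ?_
  generalize p a = b
  revert b; decide

lemma wt_eq_zero_iff {p : BPoly m} : wt p = 0 ↔ p = 0 := by
  rw [wt_eq_sum, Finset.sum_eq_zero_iff]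
  simp [funext_iff]

lemma wt_add_add_two_mul (p q : BPoly m) : wt (p + q) + 2 * wt (p * q) = wt p + wt q := by
  simp only [wt_eq_sum, Finset.mul_sum, ← Finset.sum_add_distrib]
  refine Finset.sum_congr rfl fun a _ => ?_
  simp only [Pi.add_apply, Pi.mul_apply]
  generalize p a = b
  generalize q a = c
  revert b c; decide

lemma eq_of_mul_eq_of_wt_le {p q : BPoly m} (h : p * q = p) (hw : wt q ≤ wt p) : p = q := by
  have h1 := wt_add_add_two_mul p q
  rw [h] at h1
  have h2 : wt (p + q) = 0 := by omega
  rw [wt_eq_zero_iff] at h2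
  funext a
  have h3 := congrFun h2 a
  simp only [Pi.add_apply, Pi.zero_apply] at h3
  exact CharTwo.add_eq_zero.mp h3

lemma wt_eq_wt_restrictLast (p : BPoly (m + 1)) :
    wt p = wt (restrictLast 0 p) + wt (restrictLast 1 p) := by
  simp only [wt_eq_sum, restrictLast]
  rw [← Equiv.sum_comp (Fin.snocEquiv fun _ => ZMod 2), Fintype.sum_prod_type]
  exact Fin.sum_univ_two _

lemma eq_restrictLast (p : BPoly (m + 1)) (x : Pt (m + 1)) :
    p x = restrictLast 0 p (Fin.init x)
      + x (Fin.last m) * (restrictLast 0 p + restrictLast 1 p) (Fin.init x) := by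
  have hx : p x = p (Fin.snoc (Fin.init x) (x (Fin.last m))) := by rw [Fin.snoc_init_self]
  rw [hx]
  simp only [restrictLast, Pi.add_apply]
  generalize x (Fin.last m) = b
  by_cases hb : b = 0
  · simp [hb]
  · rw [zmod_two_eq_one hb, one_mul, ← add_assoc, CharTwo.add_self_eq_zero, zero_add]

end Weight

section ReedMuller

variable {m : ℕ}

lemma evMon_mem_reedMuller {S : Finset (Fin m)} {r : ℕ} (h : S.card ≤ r) :
    evMon S ∈ reedMuller m r :=
  Submodule.subset_span ⟨S, h, rfl⟩

lemma evMon_mul_coord (S : Finset (Fin m)) (k : Fin m) :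
    (evMon S * fun x => x k) = evMon (insert k S) := by
  funext x
  by_cases hk : k ∈ S
  · rw [Finset.insert_eq_of_mem hk]
    simp only [Pi.mul_apply, evMon]
    rw [← Finset.mul_prod_erase _ _ hk]
    generalize x k = b
    generalize ∏ i ∈ S.erase k, x i = c
    revert b c; decide
  · simp [evMon, Finset.prod_insert hk, mul_comm]

lemma evMon_castSucc (S : Finset (Fin (m + 1))) (x : Pt m) (b : ZMod 2) :
    evMon S (Fin.snoc x b) =
      (if Fin.last m ∈ S then b else 1) * evMon (S.preimage Fin.castSucc
        (Fin.castSucc_injective m).injOn) x := by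
  have key : ∀ (n : ℕ) (S : Finset (Fin n)) (y : Pt n), evMon S y = ∏ i, if i ∈ S then y i else 1 := by
    intro n S y
    simp [evMon, Finset.prod_ite_mem]
  rw [key, key, Fin.prod_univ_castSucc]
  simp [mul_comm]

lemma restrictLast_mem {r : ℕ} {p : BPoly (m + 1)} (hp : p ∈ reedMuller (m + 1) r) (b : ZMod 2) :
    restrictLast b p ∈ reedMuller m r := by
  induction hp using Submodule.span_induction with
  | mem p h =>
    obtain ⟨S, hS, rfl⟩ := h
    have h1 : restrictLast b (evMon S) = (if Fin.last m ∈ S then b else 1) •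
        evMon (S.preimage Fin.castSucc (Fin.castSucc_injective m).injOn) := by
      funext x
      simp only [restrictLast, evMon_castSucc, Pi.smul_apply, smul_eq_mul]
    rw [h1]
    refine Submodule.smul_mem _ _ (evMon_mem_reedMuller (le_trans ?_ hS))
    exact Finset.card_le_card_of_injOn _ (fun i hi => by simpa using hi)
      (Fin.castSucc_injective m).injOn
  | zero => exact Submodule.zero_mem _
  | add p q _ _ h1 h2 => exact Submodule.add_mem _ h1 h2
  | smul a p _ h => exact Submodule.smul_mem _ a h

lemma restrictLast_add_mem {r : ℕ} {p : BPoly (m + 1)} (hp : p ∈ reedMuller (m + 1) (r + 1)) :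
    restrictLast 0 p + restrictLast 1 p ∈ reedMuller m r := by
  induction hp using Submodule.span_induction with
  | mem p h =>
    obtain ⟨S, hS, rfl⟩ := h
    by_cases hl : Fin.last m ∈ S
    · have h1 : restrictLast 0 (evMon S) + restrictLast 1 (evMon S) =
          evMon (S.preimage Fin.castSucc (Fin.castSucc_injective m).injOn) := by
        funext x
        simp [restrictLast, evMon_castSucc, hl]
      rw [h1]
      refine evMon_mem_reedMuller ?_
      have h2 : (S.preimage Fin.castSucc (Fin.castSucc_injective m).injOn).card ≤
          (S.erase (Fin.last m)).card :=
        Finset.card_le_card_of_injOn _ (fun i hi => by simpa using hi)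
          (Fin.castSucc_injective m).injOn
      rw [Finset.card_erase_of_mem hl] at h2
      have hS' : S.card ≤ r + 1 := hS
      omega
    · have h1 : restrictLast 0 (evMon S) + restrictLast 1 (evMon S) = 0 := by
        funext x
        simp [restrictLast, evMon_castSucc, hl, CharTwo.add_self_eq_zero]
      rw [h1]
      exact Submodule.zero_mem _
  | zero => exact (by simp [restrictLast, funext_iff] : restrictLast 0 (0 : BPoly (m + 1))
      + restrictLast 1 0 = 0) ▸ Submodule.zero_mem _
  | add p q _ _ h1 h2 =>
    convert Submodule.add_mem _ h1 h2 using 1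
    funext x
    simp only [restrictLast, Pi.add_apply]
    ring
  | smul a p _ h =>
    convert Submodule.smul_mem _ a h using 1
    funext x
    simp [restrictLast, mul_add]

lemma restrictLast_add_eq_zero {p : BPoly (m + 1)} (hp : p ∈ reedMuller (m + 1) 0) :
    restrictLast 0 p + restrictLast 1 p = 0 := by
  induction hp using Submodule.span_induction with
  | mem p h =>
    obtain ⟨S, hS, rfl⟩ := h
    obtain rfl : S = ∅ := by simpa using hS
    funext x
    simp [restrictLast, evMon, CharTwo.add_self_eq_zero]
  | zero => simp [restrictLast, funext_iff]
  | add p q _ _ h1 h2 =>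
    calc _ = (restrictLast 0 p + restrictLast 1 p) + (restrictLast 0 q + restrictLast 1 q) := by
          funext x
          simp only [restrictLast, Pi.add_apply]
          ring
      _ = 0 := by rw [h1, h2, add_zero]
  | smul a p _ h =>
    calc _ = a • (restrictLast 0 p + restrictLast 1 p) := by
          funext x
          simp [restrictLast, mul_add]
      _ = 0 := by rw [h, smul_zero]

lemma mul_mem_reedMuller_of_affineOn {r : ℕ} {p M : BPoly m} {A : Finset (Fin m)}
    (hp : p ∈ reedMuller m r) (hM : M ∈ affineOn A) : p * M ∈ reedMuller m (r + 1) := by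
  induction hM using Submodule.span_induction with
  | mem M h =>
    induction hp using Submodule.span_induction with
    | mem p h' =>
      obtain ⟨S, hS, rfl⟩ := h'
      have hS' : S.card ≤ r := hS
      rcases h with rfl | ⟨k, -, rfl⟩
      · rw [mul_one]
        exact evMon_mem_reedMuller (by omega)
      · rw [evMon_mul_coord]
        exact evMon_mem_reedMuller ((Finset.card_insert_le _ _).trans (by omega))
    | zero => rw [zero_mul]; exact Submodule.zero_mem _
    | add p q _ _ h1 h2 => rw [add_mul]; exact Submodule.add_mem _ h1 h2
    | smul a p _ h => rw [smul_mul_assoc]; exact Submodule.smul_mem _ a h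
  | zero => rw [mul_zero]; exact Submodule.zero_mem _
  | add p q _ _ h1 h2 => rw [mul_add]; exact Submodule.add_mem _ h1 h2
  | smul a p _ h => rw [mul_smul_comm]; exact Submodule.smul_mem _ a h

/-- The minimum distance bound for Reed–Muller codes. -/
lemma two_pow_le_wt_mul {m r : ℕ} {p : BPoly m} (hp : p ∈ reedMuller m r) (h0 : p ≠ 0) :
    2 ^ m ≤ wt p * 2 ^ r := by
  induction m generalizing r with
  | zero =>
    have h1 : 0 < wt p := Nat.pos_of_ne_zero (wt_eq_zero_iff.not.mpr h0)
    have h2 : 0 < 2 ^ r := by positivity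
    exact Nat.mul_pos h1 h2
  | succ m ih =>
    have hsum : restrictLast 0 p = 0 ∨ restrictLast 1 p = 0 →
        2 ^ (m + 1) ≤ wt (restrictLast 0 p + restrictLast 1 p) * 2 ^ r := by
      intro h
      have hne : restrictLast 0 p + restrictLast 1 p ≠ 0 := by
        intro hs
        have : restrictLast 0 p = 0 := by
          rcases h with h | h
          · exact h
          · simpa [h] using hs
        exact h0 (funext fun x => by rw [eq_restrictLast p x, hs, this]; simp)
      cases r with
      | zero => exact absurd (restrictLast_add_eq_zero hp) hne
      | succ r =>
        have := ih (restrictLast_add_mem hp) hne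
        rw [pow_succ, pow_succ, ← mul_assoc]
        omega
    rw [wt_eq_wt_restrictLast]
    by_cases hp0 : restrictLast 0 p = 0
    · have := hsum (Or.inl hp0)
      rw [hp0, zero_add] at this
      exact this.trans (Nat.mul_le_mul_right _ (Nat.le_add_left _ _))
    by_cases hp1 : restrictLast 1 p = 0
    · have := hsum (Or.inr hp1)
      rw [hp1, add_zero] at this
      exact this.trans (Nat.mul_le_mul_right _ (Nat.le_add_right _ _))
    have h1 := ih (restrictLast_mem hp 0) hp0
    have h2 := ih (restrictLast_mem hp 1) hp1
    rw [add_mul, pow_succ]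
    omega

end ReedMuller

section MinimumWeight

variable {m : ℕ}

lemma one_mem_affineOn (A : Finset (Fin m)) : (1 : BPoly m) ∈ affineOn A :=
  Submodule.subset_span (Set.mem_insert _ _)

lemma coord_mem_affineOn {A : Finset (Fin m)} {k : Fin m} (hk : k ∈ A) :
    (fun x : Pt m => x k) ∈ affineOn A :=
  Submodule.subset_span (Set.mem_insert_of_mem _ ⟨k, hk, rfl⟩)

lemma affineOn_mono {A B : Finset (Fin m)} (h : A ⊆ B) : affineOn A ≤ affineOn B :=
  Submodule.span_mono (Set.insert_subset_insert (Set.image_mono h))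

lemma linear_mem_affineOn (A : Finset (Fin m)) (c : Fin m → ZMod 2) (c0 : ZMod 2) :
    (fun x : Pt m => (∑ k ∈ A, c k * x k) + c0) ∈ affineOn A := by
  have h : (fun x : Pt m => (∑ k ∈ A, c k * x k) + c0) =
      (∑ k ∈ A, c k • fun x : Pt m => x k) + c0 • (1 : BPoly m) := by
    funext x
    simp
  rw [h]
  exact Submodule.add_mem _
    (Submodule.sum_mem _ fun k hk => Submodule.smul_mem _ _ (coord_mem_affineOn hk))
    (Submodule.smul_mem _ _ (one_mem_affineOn _))

lemma exists_of_mem_affineOn {A : Finset (Fin m)} {M : BPoly m} (hM : M ∈ affineOn A) :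
    ∃ (c : Fin m → ZMod 2) (c0 : ZMod 2), M = fun x => (∑ k ∈ A, c k * x k) + c0 := by
  induction hM using Submodule.span_induction with
  | mem M h =>
    rcases h with rfl | ⟨k, hk, rfl⟩
    · exact ⟨0, 1, by funext x; simp⟩
    · refine ⟨Pi.single k 1, 0, ?_⟩
      have hk' : k ∈ A := hk
      funext x
      simp [Pi.single_apply, hk']
  | zero => exact ⟨0, 0, by funext x; simp⟩
  | add p q _ _ h1 h2 =>
    obtain ⟨c, c0, rfl⟩ := h1
    obtain ⟨d, d0, rfl⟩ := h2
    refine ⟨c + d, c0 + d0, ?_⟩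
    funext x
    simp only [Pi.add_apply, add_mul, Finset.sum_add_distrib]
    ring
  | smul a p _ h =>
    obtain ⟨c, c0, rfl⟩ := h
    refine ⟨a • c, a * c0, ?_⟩
    funext x
    simp [mul_add, Finset.mul_sum, mul_assoc]

lemma mem_Tset_iff {S : Finset (Fin m)} {p : BPoly m} :
    p ∈ Tset S ↔ ∃ l : Fin m → BPoly m,
      (∀ j ∈ S, l j ∈ affineOn (Finset.univ.filter fun k => k < j ∧ k ∉ S)) ∧
      p = ∏ j ∈ S, ((fun x => x j) + l j) := by
  constructor
  · rintro ⟨c, c0, rfl⟩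
    refine ⟨_, fun j _ => linear_mem_affineOn _ (c j) (c0 j), ?_⟩
    funext x
    simp [add_assoc]
  · rintro ⟨l, hl, rfl⟩
    choose! c c0 hc using fun j hj => exists_of_mem_affineOn (hl j hj)
    refine ⟨c, c0, ?_⟩
    funext x
    rw [Finset.prod_apply]
    refine Finset.prod_congr rfl fun j hj => ?_
    rw [hc j hj, add_assoc]
    rfl

lemma init_mem_affineOn {A : Finset (Fin m)} {M : BPoly m} (hM : M ∈ affineOn A)
    {B : Finset (Fin (m + 1))} (hB : ∀ k ∈ A, k.castSucc ∈ B) :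
    (fun x : Pt (m + 1) => M (Fin.init x)) ∈ affineOn B := by
  induction hM using Submodule.span_induction with
  | mem M h =>
    rcases h with rfl | ⟨k, hk, rfl⟩
    · exact one_mem_affineOn B
    · exact coord_mem_affineOn (hB k hk)
  | zero => exact Submodule.zero_mem _
  | add p q _ _ h1 h2 => exact Submodule.add_mem _ h1 h2
  | smul a p _ h => exact Submodule.smul_mem _ a h

lemma init_mem_Tset {S : Finset (Fin m)} {p : BPoly m} (hp : p ∈ Tset S) :
    (fun x : Pt (m + 1) => p (Fin.init x)) ∈ Tset (S.map Fin.castSuccEmb) := by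
  obtain ⟨l, hl, rfl⟩ := mem_Tset_iff.mp hp
  refine mem_Tset_iff.mpr
    ⟨Fin.lastCases 0 fun j => fun x => l j (Fin.init x), fun j hj => ?_, ?_⟩
  · obtain ⟨j, hjS, rfl⟩ := Finset.mem_map.mp hj
    simp only [Fin.coe_castSuccEmb, Fin.lastCases_castSucc]
    exact init_mem_affineOn (hl j hjS) fun k hk => by simpa using hk
  · funext x
    simp [Fin.init]

lemma init_mul_mem_Tset {S : Finset (Fin m)} {p M : BPoly m} (hp : p ∈ Tset S)
    (hM : M ∈ affineOn Sᶜ) :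
    (fun x : Pt (m + 1) => p (Fin.init x) * (x (Fin.last m) + M (Fin.init x))) ∈
      Tset (insert (Fin.last m) (S.map Fin.castSuccEmb)) := by
  have hnot : Fin.last m ∉ S.map Fin.castSuccEmb := by simp [Fin.castSucc_ne_last]
  obtain ⟨l, hl, rfl⟩ := mem_Tset_iff.mp hp
  refine mem_Tset_iff.mpr
    ⟨Fin.lastCases (fun x => M (Fin.init x)) fun j => fun x => l j (Fin.init x), fun j hj => ?_, ?_⟩
  · rcases Finset.mem_insert.mp hj with rfl | hj
    · simp only [Fin.lastCases_last]
      refine init_mem_affineOn hM fun k hk => ?_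
      simpa [Fin.castSucc_ne_last, Fin.castSucc_lt_last] using hk
    · obtain ⟨j, hjS, rfl⟩ := Finset.mem_map.mp hj
      simp only [Fin.coe_castSuccEmb, Fin.lastCases_castSucc]
      exact init_mem_affineOn (hl j hjS) fun k hk => by
        simpa [Fin.castSucc_ne_last] using hk
  · funext x
    rw [Finset.prod_insert hnot]
    simp [Fin.init, mul_comm]

lemma mul_self_bpoly (p : BPoly m) : p * p = p := by
  funext x
  simp only [Pi.mul_apply]
  generalize p x = b
  revert b; decide

lemma exists_affineOn_compl_mul_eq {S : Finset (Fin m)} {q M : BPoly m} {A : Finset (Fin m)}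
    (hq : q ∈ Tset S) (hM : M ∈ affineOn A) : ∃ M' ∈ affineOn Sᶜ, q * M' = q * M := by
  obtain ⟨l, hl, rfl⟩ := mem_Tset_iff.mp hq
  induction hM using Submodule.span_induction with
  | mem M h =>
    rcases h with rfl | ⟨k, -, rfl⟩
    · exact ⟨1, one_mem_affineOn _, rfl⟩
    · by_cases hk : k ∈ S
      · refine ⟨1 + l k, Submodule.add_mem _ (one_mem_affineOn _)
          (affineOn_mono (fun j => by simp) (hl k hk)), ?_⟩
        rw [← Finset.prod_erase_mul _ _ hk, mul_assoc, mul_assoc]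
        congr 1
        funext x
        have key : ∀ b c : ZMod 2, (b + c) * (1 + c) = (b + c) * b := by decide
        exact key (x k) (l k x)
      · exact ⟨_, coord_mem_affineOn (by simpa using hk), rfl⟩
  | zero => exact ⟨0, Submodule.zero_mem _, rfl⟩
  | add p q _ _ h1 h2 =>
    obtain ⟨p', hp', hp⟩ := h1
    obtain ⟨q', hq', hq⟩ := h2
    exact ⟨p' + q', Submodule.add_mem _ hp' hq', by rw [mul_add, mul_add, hp, hq]⟩
  | smul a p _ h =>
    obtain ⟨p', hp', hp⟩ := h
    exact ⟨a • p', Submodule.smul_mem _ a hp', by rw [mul_smul_comm, mul_smul_comm, hp]⟩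

/-- A minimum-weight polynomial `p` whose support halves that of a product `q` of affine forms is
cut out of `q` by one further affine form. -/
lemma exists_affineOn_mul_eq {r : ℕ} {S S' : Finset (Fin m)} {p q : BPoly m}
    (hq : q ∈ reedMuller m r) (hqS : q ∈ Tset S') (hpS : p ∈ Tset S) (hqp : q * p = p)
    (hp0 : p ≠ 0) (hpq : p ≠ q) (hwp : wt p * 2 ^ (r + 1) = 2 ^ m)
    (hwq : wt q = wt p + wt p) : ∃ M ∈ affineOn S'ᶜ, q * M = p := by
  obtain ⟨l, hl, hpl⟩ := mem_Tset_iff.mp hpS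
  have hex : ∃ j ∈ S, q * ((fun x => x j) + l j) ≠ q := by
    by_contra! h
    have hall : ∀ A ⊆ S, q * ∏ j ∈ A, ((fun x => x j) + l j) = q := by
      intro A
      induction A using Finset.induction_on with
      | empty => simp
      | insert j A hj ih =>
        intro hA
        rw [Finset.insert_subset_iff] at hA
        rw [Finset.prod_insert hj, ← mul_assoc, h j hA.1, ih hA.2]
    have := hall S subset_rfl
    rw [← hpl, hqp] at this
    exact hpq this
  obtain ⟨j, hj, hne⟩ := hex
  set M : BPoly m := (fun x => x j) + l j with hMdef
  have hM : M ∈ affineOn (Finset.univ : Finset (Fin m)) :=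
    Submodule.add_mem _ (coord_mem_affineOn (Finset.mem_univ _))
      (affineOn_mono (Finset.subset_univ _) (hl j hj))
  have hMp : M * p = p := by
    rw [hpl, ← Finset.mul_prod_erase _ _ hj, ← mul_assoc, mul_self_bpoly]
  have hpqM : p * (q * M) = p := by
    rw [← mul_assoc, mul_comm p q, hqp, mul_comm, hMp]
  have hqM0 : q * M ≠ 0 := by
    intro h
    rw [h, mul_zero] at hpqM
    exact hp0 hpqM.symm
  have hsplit : q * M + q * (1 + M) = q := by
    rw [← mul_add, add_comm 1 M, ← add_assoc, CharTwo.add_self_eq_zero, zero_add, mul_one]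
  have hqM1 : q * (1 + M) ≠ 0 := by
    intro h
    rw [h, add_zero] at hsplit
    exact hne hsplit
  have hprod : q * M * (q * (1 + M)) = 0 := by
    have : M * (1 + M) = 0 := by
      rw [mul_add, mul_self_bpoly, mul_one, CharTwo.add_self_eq_zero]
    rw [mul_mul_mul_comm, this, mul_zero]
  have h1 := two_pow_le_wt_mul (mul_mem_reedMuller_of_affineOn hq hM) hqM0
  have h2 := two_pow_le_wt_mul (mul_mem_reedMuller_of_affineOn hq
    (Submodule.add_mem _ (one_mem_affineOn _) hM)) hqM1
  have h3 := wt_add_add_two_mul (q * M) (q * (1 + M))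
  rw [hprod, hsplit, wt_eq_zero_iff.mpr rfl, mul_zero, add_zero] at h3
  have h4 : wt p ≤ wt (q * (1 + M)) :=
    Nat.le_of_mul_le_mul_right (hwp.trans_le h2) (by positivity)
  obtain ⟨M', hM', hMM'⟩ := exists_affineOn_compl_mul_eq hqS hM
  exact ⟨M', hM', hMM'.trans (eq_of_mul_eq_of_wt_le hpqM (by omega)).symm⟩

/-- Minimum-weight words of a Reed–Muller code are products of affine forms in echelon shape. -/
lemma exists_mem_Tset_of_minWeight {m r : ℕ} {p : BPoly m} (hp : p ∈ reedMuller m r)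
    (hw : wt p * 2 ^ r = 2 ^ m) : ∃ S : Finset (Fin m), S.card = r ∧ p ∈ Tset S := by
  induction m generalizing r with
  | zero =>
    have hr : 2 ^ r = 1 := Nat.eq_one_of_mul_eq_one_left (by simpa using hw)
    have hr0 : r = 0 := by simpa using hr
    subst hr0
    refine ⟨∅, rfl, mem_Tset_iff.mpr ⟨0, by simp, ?_⟩⟩
    have hp0 : p ≠ 0 := by
      rintro rfl
      rw [wt_eq_zero_iff.mpr rfl] at hw
      simp at hw
    funext x
    rw [Finset.prod_empty, Pi.one_apply]
    refine zmod_two_eq_one fun hx => hp0 (funext fun y => ?_)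
    rw [Subsingleton.elim y x, hx]
    rfl
  | succ m ih =>
    have hsplit := wt_eq_wt_restrictLast p
    have hmem0 := restrictLast_mem hp 0
    have hmem1 := restrictLast_mem hp 1
    have hsum0 : r = 0 → restrictLast 0 p + restrictLast 1 p = 0 := by
      rintro rfl
      exact restrictLast_add_eq_zero hp
    have hsum : ∀ s, r = s + 1 → restrictLast 0 p + restrictLast 1 p ∈ reedMuller m s := by
      rintro s rfl
      exact restrictLast_add_mem hp
    have hfun : p = fun x => restrictLast 0 p (Fin.init x) + x (Fin.last m) *
        (restrictLast 0 p + restrictLast 1 p) (Fin.init x) := funext (eq_restrictLast p)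
    have hlast : ∀ S : Finset (Fin m),
        (insert (Fin.last m) (S.map Fin.castSuccEmb)).card = S.card + 1 := fun S => by
      rw [Finset.card_insert_of_notMem (by simp [Fin.castSucc_ne_last]), Finset.card_map]
    have hzero : wt (0 : BPoly m) = 0 := wt_eq_zero_iff.mpr rfl
    generalize restrictLast 0 p = p0, restrictLast 1 p = p1 at *
    by_cases hp01 : p0 = p1
    · subst hp01
      rw [CharTwo.add_self_eq_zero] at hfun
      obtain ⟨S, hS, hpS⟩ := ih hmem0 (by rw [hsplit, add_mul, pow_succ] at hw; omega)
      refine ⟨S.map Fin.castSuccEmb, by rw [Finset.card_map, hS], ?_⟩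
      rw [hfun]
      simpa using init_mem_Tset hpS
    have hq0 : p0 + p1 ≠ 0 := fun h => hp01 (CharTwo.add_eq_zero.mp h)
    cases r with
    | zero => exact absurd (hsum0 rfl) hq0
    | succ r =>
    have hmem := hsum r rfl
    have hq := wt_add_add_two_mul p0 p1
    rw [hsplit, pow_succ, pow_succ, ← mul_assoc] at hw
    have hdisj : p0 * p1 = 0 ∧ wt (p0 + p1) * 2 ^ r = 2 ^ m := by
      have h1 := two_pow_le_wt_mul hmem hq0
      have h2 : wt (p0 + p1) * 2 ^ r + 2 * (wt (p0 * p1) * 2 ^ r) = 2 ^ m := by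
        rw [← mul_assoc, ← add_mul, hq]
        omega
      have h3 : wt (p0 * p1) * 2 ^ r = 0 := by omega
      refine ⟨?_, by omega⟩
      rcases Nat.mul_eq_zero.mp h3 with h3 | h3
      · exact wt_eq_zero_iff.mp h3
      · exact absurd h3 (by positivity)
    obtain ⟨S', hS', hqS'⟩ := ih hmem hdisj.2
    suffices h : ∃ M ∈ affineOn S'ᶜ, (p0 + p1) * M = p0 by
      obtain ⟨M, hM, hMp⟩ := h
      refine ⟨insert (Fin.last m) (S'.map Fin.castSuccEmb), by rw [hlast, hS'], ?_⟩
      rw [hfun]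
      convert init_mul_mem_Tset hqS' hM using 1
      funext x
      have := congrFun hMp (Fin.init x)
      simp only [Pi.mul_apply, Pi.add_apply] at this ⊢
      rw [mul_add _ (x (Fin.last m)), this]
      ring
    by_cases hp0 : p0 = 0
    · exact ⟨0, Submodule.zero_mem _, by rw [mul_zero, hp0]⟩
    by_cases hp1 : p1 = 0
    · exact ⟨1, one_mem_affineOn _, by rw [mul_one, hp1, add_zero]⟩
    have h0 := two_pow_le_wt_mul hmem0 hp0
    have h1 := two_pow_le_wt_mul hmem1 hp1
    have hw0 : wt p0 * 2 ^ (r + 1) = 2 ^ m := by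
      rw [pow_succ, ← mul_assoc] at h0 h1 ⊢
      rw [add_mul] at hw
      omega
    have hw1 : wt p1 * 2 ^ (r + 1) = 2 ^ m := by
      rw [pow_succ, ← mul_assoc] at h0 h1 ⊢
      rw [add_mul] at hw
      omega
    have hw01 : wt p1 = wt p0 :=
      Nat.eq_of_mul_eq_mul_right (Nat.two_pow_pos (r + 1)) (hw1.trans hw0.symm)
    obtain ⟨S, -, hpS⟩ := ih hmem0 hw0
    refine exists_affineOn_mul_eq hmem hqS' hpS ?_ hp0 ?_ hw0 ?_
    · rw [add_mul, mul_comm p1, hdisj.1, add_zero, mul_self_bpoly]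
    · intro h
      exact hp1 (by simpa using h)
    · rw [hdisj.1, hzero] at hq
      omega

end MinimumWeight

section Dominance

variable {m : ℕ}

lemma Dominated.insert {U A : Finset (Fin m)} (h : Dominated U A) {k j : Fin m} (hkj : k ≤ j)
    (hj : j ∉ A) : Dominated (insert k U) (insert j A) := by
  intro t
  rw [Finset.filter_insert, Finset.filter_insert]
  have hkj' : (k : ℕ) ≤ j := hkj
  have hj' : j ∉ A.filter fun k : Fin m => t ≤ (k : ℕ) := fun h => hj (Finset.mem_filter.mp h).1
  have ht := h t
  by_cases h1 : t ≤ (k : ℕ)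
  · rw [if_pos h1, if_pos (h1.trans hkj'), Finset.card_insert_of_notMem hj']
    exact (Finset.card_insert_le _ _).trans (by omega)
  · rw [if_neg h1]
    split_ifs
    · rw [Finset.card_insert_of_notMem hj']
      omega
    · exact ht

lemma Dominated.mono {U A B : Finset (Fin m)} (h : Dominated U A) (hAB : A ⊆ B) :
    Dominated U B :=
  fun t => (h t).trans (Finset.card_le_card (Finset.filter_subset_filter _ hAB))

lemma card_filter_le_eq (U : Finset (Fin m)) (j : Fin m) :
    (U.filter fun k : Fin m => (j : ℕ) ≤ k).card =
      (U.filter fun k : Fin m => (j : ℕ) + 1 ≤ k).card + if j ∈ U then 1 else 0 := by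
  have h : (U.filter fun k : Fin m => (j : ℕ) + 1 ≤ k) =
      (U.filter fun k : Fin m => (j : ℕ) ≤ k).erase j := by
    ext k
    simp only [Finset.mem_filter, Finset.mem_erase, ne_eq, Fin.ext_iff]
    constructor
    · rintro ⟨h1, h2⟩
      exact ⟨by omega, h1, by omega⟩
    · rintro ⟨h1, h2, h3⟩
      exact ⟨h2, by omega⟩
  rw [h]
  split_ifs with hj
  · rw [Finset.card_erase_add_one (by simpa using hj)]
  · rw [Finset.erase_eq_of_notMem (by simp [hj]), add_zero]

lemma Dominated.antisymm {U S : Finset (Fin m)} (h1 : Dominated U S) (h2 : Dominated S U) :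
    U = S := by
  have h : ∀ t, _ := fun t => (h1 t).antisymm (h2 t)
  ext j
  have hj := h j
  rw [card_filter_le_eq, card_filter_le_eq, h (j + 1)] at hj
  by_cases hU : j ∈ U <;> by_cases hS : j ∈ S <;> simp_all

lemma Dominated.monLE {U S : Finset (Fin m)} (h : Dominated U S) : MonLE U S := by
  have hcard : U.card ≤ S.card := by simpa using h 0
  refine ⟨hcard, ?_⟩
  rw [List.forall₂_iff_get]
  refine ⟨by simp [Nat.sub_sub_self hcard], fun n hn hn' => ?_⟩
  have hnU : n < U.card := by simpa using hn
  have hnS : S.card - U.card + n < S.card := by omega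
  have hget : (U.sort (· ≤ ·)).get ⟨n, hn⟩ = U.orderEmbOfFin rfl ⟨n, hnU⟩ := rfl
  have hget' : ((S.sort (· ≤ ·)).drop (S.card - U.card)).get ⟨n, hn'⟩ =
      S.orderEmbOfFin rfl ⟨S.card - U.card + n, hnS⟩ := by
    rw [Finset.orderEmbOfFin_apply]
    simp
  rw [hget, hget']
  by_contra! hlt
  set u := U.orderEmbOfFin rfl ⟨n, hnU⟩ with hu
  have h1 : U.card - n ≤ (U.filter fun k : Fin m => (u : ℕ) ≤ k).card := by
    rw [← Fin.card_Ici (⟨n, hnU⟩ : Fin U.card)]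
    refine Finset.card_le_card_of_injOn (U.orderEmbOfFin rfl) (fun a ha => ?_)
      (U.orderEmbOfFin rfl).injective.injOn
    have ha' : ⟨n, hnU⟩ ≤ a := by simpa using ha
    exact Finset.mem_coe.mpr (Finset.mem_filter.mpr
      ⟨Finset.orderEmbOfFin_mem _ _ _, (U.orderEmbOfFin rfl).monotone ha'⟩)
  have h2 : (S.filter fun k : Fin m => (u : ℕ) ≤ k).card ≤
      S.card - 1 - (S.card - U.card + n) := by
    rw [← Fin.card_Ioi (⟨S.card - U.card + n, hnS⟩ : Fin S.card),
      ← Finset.card_map (S.orderEmbOfFin rfl).toEmbedding]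
    refine Finset.card_le_card fun k hk => ?_
    obtain ⟨hkS, huk⟩ := Finset.mem_filter.mp hk
    rw [← Finset.mem_coe, ← Finset.range_orderEmbOfFin S rfl] at hkS
    obtain ⟨a, rfl⟩ := hkS
    refine Finset.mem_map_of_mem _ (Finset.mem_Ioi.mpr ?_)
    exact (S.orderEmbOfFin rfl).lt_iff_lt.mp (hlt.trans_le huk)
  have := h u
  omega

lemma mem_span_of_mem_Tset {S : Finset (Fin m)} {p : BPoly m} (hp : p ∈ Tset S) :
    p ∈ Submodule.span (ZMod 2) (evMon '' {U | Dominated U S}) := by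
  obtain ⟨l, hl, rfl⟩ := mem_Tset_iff.mp hp
  have hl' : ∀ j ∈ S, (fun x => x j) + l j ∈ affineOn (Finset.univ.filter fun k => k ≤ j) := by
    intro j hj
    refine Submodule.add_mem _ (coord_mem_affineOn (by simp)) (affineOn_mono ?_ (hl j hj))
    intro k hk
    simpa using (Finset.mem_filter.mp hk).2.1.le
  clear hl hp
  induction S using Finset.induction_on with
  | empty => exact Submodule.subset_span ⟨∅, fun t => by simp, by funext x; simp [evMon]⟩
  | insert j A hj ih =>
    rw [Finset.prod_insert hj, mul_comm]
    have hA := ih fun i hi => hl' i (Finset.mem_insert_of_mem hi)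
    have hM := hl' j (Finset.mem_insert_self _ _)
    generalize ∏ j ∈ A, ((fun x : Pt m => x j) + l j) = p at hA
    generalize ((fun x : Pt m => x j) + l j) = M at hM
    clear hl' ih
    induction hM using Submodule.span_induction with
    | mem M h =>
      induction hA using Submodule.span_induction with
      | mem p h' =>
        obtain ⟨U, hU, rfl⟩ := h'
        rcases h with rfl | ⟨k, hk, rfl⟩
        · rw [mul_one]
          exact Submodule.subset_span ⟨U, hU.mono (Finset.subset_insert _ _), rfl⟩
        · rw [evMon_mul_coord]
          exact Submodule.subset_span ⟨_, Dominated.insert hU (by simpa using hk) hj, rfl⟩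
      | zero => rw [zero_mul]; exact Submodule.zero_mem _
      | add p q _ _ h1 h2 => rw [add_mul]; exact Submodule.add_mem _ h1 h2
      | smul a p _ h => rw [smul_mul_assoc]; exact Submodule.smul_mem _ a h
    | zero => rw [mul_zero]; exact Submodule.zero_mem _
    | add p q _ _ h1 h2 => rw [mul_add]; exact Submodule.add_mem _ h1 h2
    | smul a p _ h => rw [mul_smul_comm]; exact Submodule.smul_mem _ a h

lemma coeff_evMon_of_ne {S U : Finset (Fin m)} (h : U ≠ S) : coeff S (evMon U) = 0 := by
  classical
  rw [coeff]
  by_cases hUS : U ⊆ S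
  · obtain ⟨i, hiS, hiU⟩ := Finset.exists_of_ssubset (hUS.ssubset_of_ne h)
    have hne : ∀ b : ZMod 2, b + 1 ≠ b := by decide
    refine Finset.sum_involution (fun a _ => Function.update a i (a i + 1)) ?_ ?_ ?_ ?_
    · intro a _
      have : evMon U (Function.update a i (a i + 1)) = evMon U a :=
        Finset.prod_congr rfl fun j hj => by
          rw [Function.update_of_ne (by rintro rfl; exact hiU hj)]
      rw [this, CharTwo.add_self_eq_zero]
    · intro a _ _ ha
      have := congrFun ha i
      rw [Function.update_self] at this
      exact hne _ this
    · intro a ha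
      rw [Finset.mem_filter] at ha ⊢
      refine ⟨Finset.mem_univ _, fun j hj => ?_⟩
      by_cases hji : j = i
      · exact hji ▸ hiS
      · exact ha.2 j (by rwa [Function.update_of_ne hji] at hj)
    · intro a _
      simp [add_assoc, CharTwo.add_self_eq_zero]
  · obtain ⟨i, hiU, hiS⟩ := Finset.not_subset.mp hUS
    refine Finset.sum_eq_zero fun a ha => Finset.prod_eq_zero hiU ?_
    by_contra hai
    exact hiS ((Finset.mem_filter.mp ha).2 i (zmod_two_eq_one hai))

lemma coeff_eq_zero_of_mem_span {𝒰 : Set (Finset (Fin m))} {S : Finset (Fin m)} {p : BPoly m}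
    (hp : p ∈ Submodule.span (ZMod 2) (evMon '' 𝒰)) (hS : S ∉ 𝒰) : coeff S p = 0 := by
  induction hp using Submodule.span_induction with
  | mem p h =>
    obtain ⟨U, hU, rfl⟩ := h
    exact coeff_evMon_of_ne fun h => hS (h ▸ hU)
  | zero => simp [coeff]
  | add p q _ _ h1 h2 =>
    rw [coeff] at h1 h2 ⊢
    simp only [Pi.add_apply, Finset.sum_add_distrib, h1, h2, add_zero]
  | smul a p _ h =>
    rw [coeff] at h ⊢
    simp only [Pi.smul_apply, ← Finset.smul_sum, h, smul_zero]

lemma coeff_of_mem_Tset {S : Finset (Fin m)} {p : BPoly m} (hp : p ∈ Tset S) :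
    coeff S p = 1 := by
  obtain ⟨c, c0, rfl⟩ := hp
  have hval : ∀ a : Pt m, (∀ i, a i = 1 → i ∈ S) →
      (∏ j ∈ S, (a j + (∑ k ∈ Finset.univ.filter (fun k => k < j ∧ k ∉ S), c j k * a k) + c0 j)) =
        ∏ j ∈ S, (a j + c0 j) := by
    intro a ha
    refine Finset.prod_congr rfl fun j _ => ?_
    rw [Finset.sum_eq_zero, add_zero]
    intro k hk
    have : a k = 0 := by
      by_contra hak
      exact (Finset.mem_filter.mp hk).2.2 (ha k (zmod_two_eq_one hak))
    rw [this, mul_zero]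
  rw [coeff, Finset.sum_congr rfl fun a ha => hval a (Finset.mem_filter.mp ha).2]
  have key : ∀ b b' : ZMod 2, b' ≠ 1 + b → b' + b = 0 := by decide
  rw [Finset.sum_eq_single (fun j => if j ∈ S then 1 + c0 j else 0)]
  · refine Finset.prod_eq_one fun j hj => ?_
    simp only [if_pos hj]
    rw [add_assoc, CharTwo.add_self_eq_zero, add_zero]
  · intro a ha hne
    obtain ⟨j, hj⟩ := Function.ne_iff.mp hne
    by_cases hjS : j ∈ S
    · rw [if_pos hjS] at hj
      exact Finset.prod_eq_zero hjS (key _ _ hj)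
    · rw [if_neg hjS] at hj
      exact absurd ((Finset.mem_filter.mp ha).2 j (zmod_two_eq_one hj)) hjS
  · intro h
    refine absurd (Finset.mem_filter.mpr ⟨Finset.mem_univ _, fun j hj => ?_⟩) h
    by_contra hjS
    simp [hjS] at hj

lemma Tset_injective {S S' : Finset (Fin m)} {p : BPoly m} (h : p ∈ Tset S) (h' : p ∈ Tset S') :
    S = S' := by
  have key : ∀ {S S' : Finset (Fin m)}, p ∈ Tset S → p ∈ Tset S' → Dominated S S' := by
    intro S S' h h'
    by_contra hd
    have := coeff_eq_zero_of_mem_span (mem_span_of_mem_Tset h') hd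
    rw [coeff_of_mem_Tset h] at this
    exact one_ne_zero this
  exact (key h h').antisymm (key h' h)

end Dominance

section Counting

variable {m : ℕ}

lemma wt_evMon (S : Finset (Fin m)) : wt (evMon S) = 2 ^ (m - S.card) := by
  classical
  have h : (Finset.univ.filter fun a : Pt m => evMon S a = 1) =
      Fintype.piFinset fun k => if k ∈ S then {1} else Finset.univ := by
    ext a
    simp only [Finset.mem_filter, Finset.mem_univ, true_and, Fintype.mem_piFinset]
    constructor
    · intro ha k
      split_ifs with hk
      · rw [Finset.mem_singleton]
        refine zmod_two_eq_one fun h0 => ?_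
        rw [evMon, Finset.prod_eq_zero hk h0] at ha
        exact zero_ne_one ha
      · exact Finset.mem_univ _
    · intro ha
      refine Finset.prod_eq_one fun k hk => ?_
      simpa [hk] using ha k
  have hcard : ∀ k, (if k ∈ S then ({1} : Finset (ZMod 2)) else Finset.univ).card =
      if k ∈ S then 1 else 2 := by
    intro k
    split_ifs <;> rfl
  rw [wt, h, Fintype.card_piFinset, Finset.prod_congr rfl fun k _ => hcard k, Finset.prod_ite,
    Finset.prod_const_one, one_mul, Finset.prod_const, Finset.filter_not, Finset.filter_mem_eq_inter,
    Finset.univ_inter, ← Finset.compl_eq_univ_sdiff, Finset.card_compl, Fintype.card_fin]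

lemma wt_of_mem_Tset {S : Finset (Fin m)} {p : BPoly m} (hp : p ∈ Tset S) :
    wt p = 2 ^ (m - S.card) := by
  obtain ⟨c, c0, rfl⟩ := hp
  set g : Fin m → Pt m → ZMod 2 := fun j x =>
    if j ∈ S then (∑ k ∈ Finset.univ.filter (fun k => k < j ∧ k ∉ S), c j k * x k) + c0 j else 0
    with hg
  let φ : Pt m → Pt m := fun x j => x j + g j x
  have hφg : ∀ j x, g j (φ x) = g j x := by
    intro j x
    simp only [hg]
    split_ifs
    · congr 1
      refine Finset.sum_congr rfl fun k hk => ?_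
      simp [φ, hg, (Finset.mem_filter.mp hk).2.2]
    · rfl
  have hφ : Function.Involutive φ := by
    intro x
    funext j
    change φ x j + g j (φ x) = x j
    rw [hφg]
    change x j + g j x + g j x = x j
    rw [add_assoc, CharTwo.add_self_eq_zero, add_zero]
  rw [← wt_evMon S, wt_eq_sum, wt_eq_sum]
  refine Fintype.sum_equiv hφ.toPerm _ _ fun x => congrArg ZMod.val (Finset.prod_congr rfl fun j hj => ?_)
  simp [φ, hg, hj, add_assoc]

lemma Dnat_add_Dnat_add_one (a : Pt m) : Dnat a + Dnat (a + 1) = 2 ^ m + 1 := by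
  have h : ∀ b : ZMod 2, (1 - b.val) + (1 - (b + 1).val) = 1 := by decide
  have h2 : (∑ i : Fin m, 2 ^ (i : ℕ) * (1 - (a i).val)) +
      ∑ i : Fin m, 2 ^ (i : ℕ) * (1 - ((a + 1) i).val) = ∑ i : Fin m, 2 ^ (i : ℕ) := by
    rw [← Finset.sum_add_distrib]
    refine Finset.sum_congr rfl fun i _ => ?_
    rw [← mul_add]
    exact (congrArg _ (h (a i))).trans (mul_one _)
  rw [Fin.sum_univ_eq_sum_range (fun i => 2 ^ i)] at h2
  have h3 := Nat.geomSum_eq (le_refl 2) m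
  have h4 := Nat.one_le_two_pow (n := m)
  simp only [Dnat]
  omega

lemma one_le_Dnat (a : Pt m) : 1 ≤ Dnat a := Nat.le_add_left _ _

lemma Dnat_le (a : Pt m) : Dnat a ≤ 2 ^ m := by
  have h1 := Dnat_add_Dnat_add_one a
  have h2 := one_le_Dnat (a + 1)
  omega

lemma pt_add_one_add_one (a : Pt m) : a + 1 + 1 = a := by
  funext k
  change a k + 1 + 1 = a k
  rw [add_assoc, CharTwo.add_self_eq_zero, add_zero]

lemma translate_mem_Tset {S : Finset (Fin m)} {p : BPoly m} (hp : p ∈ Tset S) :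
    (fun a => p (a + 1)) ∈ Tset S := by
  have hA : ∀ {A : Finset (Fin m)} {M : BPoly m}, M ∈ affineOn A →
      (fun a => M (a + 1)) ∈ affineOn A := by
    intro A M hM
    induction hM using Submodule.span_induction with
    | mem M h =>
      rcases h with rfl | ⟨k, hk, rfl⟩
      · exact one_mem_affineOn A
      · exact Submodule.add_mem _ (coord_mem_affineOn hk) (one_mem_affineOn A)
    | zero => exact Submodule.zero_mem _
    | add p q _ _ h1 h2 => exact Submodule.add_mem _ h1 h2
    | smul a p _ h => exact Submodule.smul_mem _ a h
  obtain ⟨l, hl, rfl⟩ := mem_Tset_iff.mp hp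
  refine mem_Tset_iff.mpr ⟨fun j => 1 + fun a => l j (a + 1), fun j hj =>
    Submodule.add_mem _ (one_mem_affineOn _) (hA (hl j hj)), ?_⟩
  funext a
  simp [add_assoc]

/-- Translation by the all-ones vector reverses positions, exchanging polynomials supported on the
last positions with polynomials supported on the first ones. -/
lemma Pf_eq_ncard {S : Finset (Fin m)} {i : ℕ} (hi : i ≤ 2 ^ m) :
    Pf S (2 ^ (m - S.card)) i =
      {p : BPoly m | p ∈ Tset S ∧ ∀ a, 2 ^ m - i < Dnat a → p a = 0}.ncard := by
  have hinj : Function.Injective fun (p : BPoly m) (a : Pt m) => p (a + 1) := by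
    intro p q h
    funext a
    simpa [pt_add_one_add_one] using congrFun h (a + 1)
  rw [Pf, ← Set.ncard_image_of_injective _ hinj]
  congr 1
  have hiff : ∀ p ∈ Tset S, wtIn p (i + 1) (2 ^ m) = 2 ^ (m - S.card) ↔
      ∀ a, Dnat a ≤ i → p a = 0 := by
    intro p hp
    rw [← wt_of_mem_Tset hp, wtIn, wt]
    have hsub : (Finset.univ.filter fun a : Pt m => i + 1 ≤ Dnat a ∧ Dnat a ≤ 2 ^ m ∧ p a = 1) ⊆
        Finset.univ.filter fun a : Pt m => p a = 1 :=
      Finset.monotone_filter_right _ fun a _ ha => ha.2.2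
    constructor
    · intro h a ha
      by_contra h0
      have hmem : a ∈ Finset.univ.filter fun a : Pt m => p a = 1 :=
        Finset.mem_filter.mpr ⟨Finset.mem_univ _, zmod_two_eq_one h0⟩
      rw [← Finset.eq_of_subset_of_card_le hsub h.ge] at hmem
      have := (Finset.mem_filter.mp hmem).2.1
      omega
    · intro h
      refine congrArg _ (hsub.antisymm fun a ha => ?_)
      rw [Finset.mem_filter] at ha ⊢
      refine ⟨ha.1, ?_, Dnat_le a, ha.2⟩
      by_contra hlt
      have := h a (by omega)
      rw [ha.2] at this
      exact one_ne_zero this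
  ext p
  simp only [Set.mem_image, Set.mem_ofPred_eq]
  constructor
  · rintro ⟨q, ⟨hq, hw⟩, rfl⟩
    refine ⟨translate_mem_Tset hq, fun a ha => (hiff q hq).mp hw _ ?_⟩
    have := Dnat_add_Dnat_add_one a
    omega
  · rintro ⟨hp, h⟩
    refine ⟨fun a => p (a + 1), ⟨translate_mem_Tset hp,
      (hiff _ (translate_mem_Tset hp)).mpr fun a ha => h _ ?_⟩, ?_⟩
    · have := Dnat_add_Dnat_add_one a
      omega
    · funext a
      exact congrArg p (pt_add_one_add_one a)

/-- The minimum-weight words of a decreasing monomial code of maximum degree `r` are the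
polynomials in the sets `T(f)` for monomials `f` of degree `r` in the code. -/
lemma mem_Ccode_and_wt_iff {r : ℕ} {ℐ : Finset (Finset (Fin m))}
    (hdec : ∀ S T : Finset (Fin m), MonLE S T → T ∈ ℐ → S ∈ ℐ)
    (hmax : ∀ S ∈ ℐ, S.card ≤ r) (hr : r ≤ m) (p : BPoly m) :
    p ∈ Ccode ℐ ∧ wt p = 2 ^ (m - r) ↔ ∃ S ∈ ℐ.filter (fun S => S.card = r), p ∈ Tset S := by
  constructor
  · rintro ⟨hp, hw⟩
    have hpr : p ∈ reedMuller m r := Submodule.span_mono (Set.image_mono hmax) hp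
    obtain ⟨S, hS, hpS⟩ := exists_mem_Tset_of_minWeight hpr
      (by rw [hw, ← pow_add, Nat.sub_add_cancel hr])
    refine ⟨S, Finset.mem_filter.mpr ⟨?_, hS⟩, hpS⟩
    by_contra hSI
    have := coeff_eq_zero_of_mem_span hp hSI
    rw [coeff_of_mem_Tset hpS] at this
    exact one_ne_zero this
  · rintro ⟨S, hS, hpS⟩
    obtain ⟨hSI, rfl⟩ := Finset.mem_filter.mp hS
    refine ⟨Submodule.span_mono (Set.image_mono fun U hU => ?_) (mem_span_of_mem_Tset hpS),
      wt_of_mem_Tset hpS⟩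
    exact hdec U S (Dominated.monLE hU) hSI

end Counting

/-- for a decreasing ℐ with maximum degree r, 0 ≤ i ≤ N, and the
Wang-Liu shortening pattern Y_i = {N−i+1,…,N}, the number of weight-2^{m−r}
codewords of C_S(ℐ, Y_i) equals Σ_{f ∈ ℐ, deg f = r} P_f(2^{m−r}, i).
(Codewords of C_S(ℐ,Y_i) are identified with the codewords c ∈ C(ℐ) vanishing on
Y_i — this identification is injective — and the weight of the restriction to the
surviving positions {1,…,N−i} is counted.) -/
theorem stmt15 (m r : ℕ) (hm : 1 ≤ m) (ℐ : Finset (Finset (Fin m)))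
    (hdec : ∀ S T : Finset (Fin m), MonLE S T → T ∈ ℐ → S ∈ ℐ)
    (hmax : ∀ S ∈ ℐ, S.card ≤ r) (hmax' : ∃ S ∈ ℐ, S.card = r)
    (i : ℕ) (hi : i ≤ 2 ^ m) :
    {c : BPoly m | c ∈ Ccode ℐ ∧
        (∀ a : Pt m, 2 ^ m - i < Dnat a → c a = 0) ∧
        {a : Pt m | Dnat a ≤ 2 ^ m - i ∧ c a = 1}.ncard = 2 ^ (m - r)}.ncard
      = ∑ S ∈ ℐ.filter (fun S => S.card = r), Pf S (2 ^ (m - r)) i := by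
  classical
  have hr : r ≤ m := by
    obtain ⟨S, -, rfl⟩ := hmax'
    simpa using Finset.card_le_univ S
  have hset : {c : BPoly m | c ∈ Ccode ℐ ∧ (∀ a : Pt m, 2 ^ m - i < Dnat a → c a = 0) ∧
        {a : Pt m | Dnat a ≤ 2 ^ m - i ∧ c a = 1}.ncard = 2 ^ (m - r)} =
      ((ℐ.filter fun S => S.card = r).biUnion fun S =>
        {p : BPoly m | p ∈ Tset S ∧ ∀ a, 2 ^ m - i < Dnat a → p a = 0}.toFinset :
          Finset (BPoly m)) := by
    ext c
    simp only [Set.mem_ofPred_eq, Finset.coe_biUnion, Set.coe_toFinset, Set.mem_iUnion,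
      Finset.mem_coe, exists_prop]
    have hwt : (∀ a : Pt m, 2 ^ m - i < Dnat a → c a = 0) →
        {a : Pt m | Dnat a ≤ 2 ^ m - i ∧ c a = 1}.ncard = wt c := by
      intro h
      rw [wt, ← Set.ncard_coe_finset]
      congr 1
      ext a
      simp only [Set.mem_ofPred_eq, Finset.coe_filter, Finset.mem_univ, true_and,
        and_iff_right_iff_imp]
      intro ha
      by_contra hlt
      rw [h a (by omega)] at ha
      exact zero_ne_one ha
    constructor
    · rintro ⟨hc, h0, hw⟩
      rw [hwt h0] at hw
      obtain ⟨S, hS, hcS⟩ := (mem_Ccode_and_wt_iff hdec hmax hr c).mp ⟨hc, hw⟩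
      exact ⟨S, hS, hcS, h0⟩
    · rintro ⟨S, hS, hcS, h0⟩
      obtain ⟨hc, hw⟩ := (mem_Ccode_and_wt_iff hdec hmax hr c).mpr ⟨S, hS, hcS⟩
      exact ⟨hc, h0, (hwt h0).trans hw⟩
  rw [hset, Set.ncard_coe_finset, Finset.card_biUnion]
  · refine Finset.sum_congr rfl fun S hS => ?_
    obtain rfl := (Finset.mem_filter.mp hS).2
    rw [Pf_eq_ncard hi, Set.ncard_eq_toFinset_card']
  · intro S _ S' _ hne
    rw [Function.onFun, Finset.disjoint_left]
    intro p hp hp'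
    rw [Set.mem_toFinset] at hp hp'
    exact hne (Tset_injective hp.1 hp'.1)
end

section
/- Let m ≥ 1, N = 2^m, and u ∈ 𝔽₂^N, and set c := uF_N. Writing v_o := (v_1, v_3, …, v_{N−1}) and v_e := (v_2, v_4, …, v_N) for the odd- and even-indexed subvectors of a vector v ∈ 𝔽₂^N, we have c_o = (u_o ⊕ u_e) F_{N/2} and c_e = u_e F_{N/2}, where F_{N/2} is the analogous matrix for m−1. -/
open Finset

/-- The matrix F_N (N = 2^m) over 𝔽₂, in the paper's indexing: the entry in row
D(a) and column D(b) (a,b ∈ 𝔽₂^m, D(a) = Σ 2^{i-1}(a_i ⊕ 1) + 1) equals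
∏_{i : a_i = 1} b_i. With 0-based indices r = D(a) − 1, c = D(b) − 1 this reads:
a_i = 1 ⟺ ¬testBit r (i-1), b_i = 1 ⟺ ¬testBit c (i-1). -/
def Fmat (m : ℕ) : Matrix (Fin (2 ^ m)) (Fin (2 ^ m)) (ZMod 2) :=
  Matrix.of fun r c => ∏ i ∈ Finset.range m,
    (if (r : ℕ).testBit i = false then
        (if (c : ℕ).testBit i = false then (1 : ZMod 2) else 0)
      else 1)

/-- Hamming weight of the restriction of a vector to positions {i+1,…,n}
(position k ∈ {1,…,n} corresponds to index k − 1 : Fin n). -/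
def wtFrom {n : ℕ} (v : Fin n → ZMod 2) (i : ℕ) : ℕ :=
  (Finset.univ.filter (fun c : Fin n => i ≤ (c : ℕ) ∧ v c = 1)).card

/-- odd-indexed subvector v_o = (v_1, v_3, …, v_{N-1}) (1-based positions). -/
def oddPart {n : ℕ} (v : Fin (2 ^ (n + 1)) → ZMod 2) : Fin (2 ^ n) → ZMod 2 :=
  fun k => v ⟨2 * (k : ℕ), by have h := k.isLt; rw [pow_succ]; omega⟩

/-- even-indexed subvector v_e = (v_2, v_4, …, v_N) (1-based positions). -/
def evenPart {n : ℕ} (v : Fin (2 ^ (n + 1)) → ZMod 2) : Fin (2 ^ n) → ZMod 2 :=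
  fun k => v ⟨2 * (k : ℕ) + 1, by have h := k.isLt; rw [pow_succ]; omega⟩

/-- Punctured polar coset spectrum A_d(μ, v, Z): the number of ṽ ∈ 𝔽₂^{2^μ} whose
first j entries agree with v and such that the restriction of ṽF_{2^μ} to the
positions {1,…,2^μ} ∖ Z has Hamming weight d. -/
noncomputable def Apunct (μ : ℕ) (j : ℕ) (v : ℕ → ZMod 2) (Z : Finset ℕ) (d : ℕ) : ℕ :=
  {w : Fin (2 ^ μ) → ZMod 2 |
    (∀ k : Fin (2 ^ μ), (k : ℕ) < j → w k = v (k : ℕ)) ∧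
    (Finset.univ.filter (fun c : Fin (2 ^ μ) =>
        ((c : ℕ) + 1) ∉ Z ∧ Matrix.vecMul w (Fmat μ) c = 1)).card = d}.ncard

/-- Shortened polar coset spectrum A^S_d(μ, v, Z): additionally ṽF_{2^μ} must
vanish on all positions of Z. -/
noncomputable def Ashort (μ : ℕ) (j : ℕ) (v : ℕ → ZMod 2) (Z : Finset ℕ) (d : ℕ) : ℕ :=
  {w : Fin (2 ^ μ) → ZMod 2 |
    (∀ k : Fin (2 ^ μ), (k : ℕ) < j → w k = v (k : ℕ)) ∧
    (∀ c : Fin (2 ^ μ), ((c : ℕ) + 1) ∈ Z → Matrix.vecMul w (Fmat μ) c = 0) ∧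
    (Finset.univ.filter (fun c : Fin (2 ^ μ) =>
        ((c : ℕ) + 1) ∉ Z ∧ Matrix.vecMul w (Fmat μ) c = 1)).card = d}.ncard

/-- A sum over `Fin (2 ^ (n + 1))` splits into the sums over the two index parities. -/
theorem sum_eq_sum_oddPart_add_sum_evenPart {n : ℕ} (f : Fin (2 ^ (n + 1)) → ZMod 2) :
    ∑ r, f r = ∑ k, (oddPart f k + evenPart f k) := by
  rw [← Equiv.sum_comp (finProdFinEquiv.trans (finCongr (pow_succ 2 n).symm)) f,
    Fintype.sum_prod_type]
  refine Finset.sum_congr rfl fun k _ => ?_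
  rw [Fin.sum_univ_two]
  congr 1 <;>
  · simp only [oddPart, evenPart]
    congr 1
    ext
    simp [finProdFinEquiv, add_comm]

/-- The Kronecker recursion for `Fmat`: an entry of `Fmat (m + 1)` is the product of the factor
coming from the lowest bits and an entry of `Fmat m`. -/
theorem Fmat_succ_apply {m : ℕ} (r c : Fin (2 ^ (m + 1))) (k l : Fin (2 ^ m))
    (hr : (r : ℕ) / 2 = k) (hc : (c : ℕ) / 2 = l) :
    Fmat (m + 1) r c =
      Fmat m k l * (if (r : ℕ).testBit 0 = false then
        (if (c : ℕ).testBit 0 = false then 1 else 0) else 1) := by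
  simp only [Fmat, Matrix.of_apply, Finset.prod_range_succ', Nat.testBit_succ, hr, hc]

/-- for u ∈ 𝔽₂^N, N = 2^{m+1}, and c := uF_N:
c_o = (u_o ⊕ u_e) F_{N/2} and c_e = u_e F_{N/2}. -/
theorem stmt16 (m : ℕ) (u : Fin (2 ^ (m + 1)) → ZMod 2) :
    oddPart (Matrix.vecMul u (Fmat (m + 1)))
        = Matrix.vecMul (fun k => oddPart u k + evenPart u k) (Fmat m) ∧
      evenPart (Matrix.vecMul u (Fmat (m + 1)))
        = Matrix.vecMul (evenPart u) (Fmat m) := by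
  constructor <;> ext l
  · simp only [oddPart, Matrix.vecMul, dotProduct]
    rw [sum_eq_sum_oddPart_add_sum_evenPart]
    refine Finset.sum_congr rfl fun k _ => ?_
    simp only [oddPart, evenPart]
    rw [Fmat_succ_apply _ _ k l (by simp) (by simp),
      Fmat_succ_apply _ _ k l (by simp; omega) (by simp)]
    simp [add_mul]
  · simp only [evenPart, Matrix.vecMul, dotProduct]
    rw [sum_eq_sum_oddPart_add_sum_evenPart]
    refine Finset.sum_congr rfl fun k _ => ?_
    simp only [oddPart, evenPart]
    rw [Fmat_succ_apply _ _ k l (by simp) (by simp; omega),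
      Fmat_succ_apply _ _ k l (by simp; omega) (by simp; omega)]
    simp
end
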